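/- arXiv:2510.15083 — 2 statements merged into one kernel-verified Lean document; each statement's English description precedes it below -/
import Mathlib

section
/- (Theorem 2.2, expected recall of ReconSMOTE under the Poisson approximation.) Let n ≥ 1 and k ≥ 3 be integers and λ > 0. On a probability space (Ω, P), let C_{i,j} for i ∈ {1,…,n} and j ∈ {1,…,k} be (not necessarily independent) ℕ-valued random variables, each distributed Poisson(λ). Say record i is identifiable if at least 3 of the k counts C_{i,1}, …, C_{i,k} are at least 3, and define Recall = (1/n)·#{i : i is identifiable}. Then E[Recall] ≥ max{0, (k·(1 − e^{−λ}(1 + λ + λ²/2)) − 2)/(k − 2)}. -/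
open MeasureTheory

/-- If `N` of `k` events occur, the indicator of `3 ≤ N` is at least `(N - 2) / (k - 2)`. -/
lemma count_sub_two_div_le_ite {N k : ℕ} (hk : 3 ≤ k) (hN : N ≤ k) :
    ((N : ℝ) - 2) / ((k : ℝ) - 2) ≤ if 3 ≤ N then 1 else 0 := by
  have hk' : (3 : ℝ) ≤ k := by exact_mod_cast hk
  have hN' : (N : ℝ) ≤ k := by exact_mod_cast hN
  split_ifs with h
  · rw [div_le_one (by linarith)]
    linarith
  · have h2 : (N : ℝ) ≤ 2 := by exact_mod_cast (by omega : N ≤ 2)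
    exact div_nonpos_of_nonpos_of_nonneg (by linarith) (by linarith)

/-- The upper tail at `3` of a Poisson random variable. -/
lemma measureReal_three_le_of_poisson {Ω : Type*} [MeasurableSpace Ω] (P : Measure Ω)
    [IsProbabilityMeasure P] {lam : ℝ} {X : Ω → ℕ} (hX : Measurable X)
    (hpois : ∀ m : ℕ,
      (P {ω | X ω = m}).toReal = Real.exp (-lam) * lam ^ m / m.factorial) :
    P.real {ω | 3 ≤ X ω} = 1 - Real.exp (-lam) * (1 + lam + lam ^ 2 / 2) := by
  have hm : MeasurableSet {ω | 3 ≤ X ω} := hX measurableSet_Ici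
  have hcompl : {ω | 3 ≤ X ω}ᶜ = X ⁻¹' ((Finset.range 3 : Finset ℕ) : Set ℕ) := by
    ext ω
    simp
  have hsum : P.real {ω | 3 ≤ X ω}ᶜ = ∑ m ∈ Finset.range 3, P.real {ω | X ω = m} := by
    rw [hcompl]
    exact (sum_measureReal_preimage_singleton (Finset.range 3)
      fun m _ => hX (measurableSet_singleton m)).symm
  have htotal := probReal_add_probReal_compl (μ := P) hm
  simp only [measureReal_def, hpois] at hsum htotal ⊢
  simp only [Finset.sum_range_succ, Finset.sum_range_zero, Nat.factorial] at hsum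
  norm_num at hsum
  linarith

/-- The number of events that occur, out of finitely many, has finite expectation, namely the
sum of their probabilities. -/
lemma integrable_card_filter_and_integral {Ω ι : Type*} [MeasurableSpace Ω] (P : Measure Ω)
    [IsProbabilityMeasure P] [Fintype ι] (p : ι → Ω → Prop) [∀ i ω, Decidable (p i ω)]
    (hp : ∀ i, MeasurableSet {ω | p i ω}) :
    Integrable (fun ω => ((Finset.univ.filter fun i => p i ω).card : ℝ)) P ∧
      ∫ ω, ((Finset.univ.filter fun i => p i ω).card : ℝ) ∂P = ∑ i, P.real {ω | p i ω} := by
  have hcard : (fun ω => ((Finset.univ.filter fun i => p i ω).card : ℝ)) =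
      fun ω => ∑ i, {ω | p i ω}.indicator (fun _ => (1 : ℝ)) ω := by
    ext ω
    rw [Finset.card_filter]
    push_cast
    exact Finset.sum_congr rfl fun i _ => by simp [Set.indicator_apply]
  have hint : ∀ i, Integrable ({ω | p i ω}.indicator fun _ => (1 : ℝ)) P := fun i =>
    (integrable_const 1).indicator (hp i)
  rw [hcard]
  refine ⟨integrable_finsetSum _ fun i _ => hint i, ?_⟩
  rw [integral_finsetSum _ fun i _ => hint i]
  exact Finset.sum_congr rfl fun i _ => by simp [integral_indicator_const _ (hp i)]

/-- **Theorem 2.2, expected recall of ReconSMOTE under the Poisson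
approximation.** Let `n ≥ 1`, `k ≥ 3`, `λ > 0`, and let `C i j` (for `i ∈ {1,…,n}`,
`j ∈ {1,…,k}`) be (not necessarily independent) `ℕ`-valued random variables, each
Poisson(λ)-distributed. Record `i` is identifiable if at least 3 of the `k` counts
`C i 1, …, C i k` are at least 3, and `Recall` is the fraction of identifiable records.
Then `E[Recall] ≥ max {0, (k(1 − e^{−λ}(1 + λ + λ²/2)) − 2)/(k − 2)}`. -/
theorem reconSMOTE_expected_recall_poisson
    {Ω : Type*} [MeasurableSpace Ω] (P : Measure Ω) [IsProbabilityMeasure P]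
    (n k : ℕ) (hn : 1 ≤ n) (hk : 3 ≤ k) (lam : ℝ) (hlam : 0 < lam)
    (C : Fin n → Fin k → Ω → ℕ) (hmeas : ∀ i j, Measurable (C i j))
    (hpois : ∀ i j (m : ℕ),
      (P {ω | C i j ω = m}).toReal = Real.exp (-lam) * lam ^ m / m.factorial) :
    max 0 (((k : ℝ) * (1 - Real.exp (-lam) * (1 + lam + lam ^ 2 / 2)) - 2) / ((k : ℝ) - 2))
      ≤ ∫ ω, (((Finset.univ.filter (fun i : Fin n =>
          3 ≤ (Finset.univ.filter (fun j : Fin k => 3 ≤ C i j ω)).card)).card : ℝ) / n) ∂P := by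
  have hn' : (0 : ℝ) < n := by exact_mod_cast hn
  have hk' : (3 : ℝ) ≤ k := by exact_mod_cast hk
  refine max_le (integral_nonneg fun ω => by positivity) ?_
  set q : ℝ := 1 - Real.exp (-lam) * (1 + lam + lam ^ 2 / 2)
  have hcount := fun i => integrable_card_filter_and_integral P (fun j ω => 3 ≤ C i j ω)
    fun j => hmeas i j measurableSet_Ici
  have hident : ∀ i, MeasurableSet
      {ω | 3 ≤ (Finset.univ.filter (fun j : Fin k => 3 ≤ C i j ω)).card} := fun i => by
    simp only [Finset.card_filter]
    refine measurableSet_le measurable_const (Finset.measurable_sum _ fun j _ => ?_)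
    exact Measurable.ite (hmeas i j measurableSet_Ici) measurable_const measurable_const
  obtain ⟨-, hrecall⟩ := integrable_card_filter_and_integral P
    (fun i ω => 3 ≤ (Finset.univ.filter (fun j : Fin k => 3 ≤ C i j ω)).card) hident
  have hrecord : ∀ i, (k * q - 2) / ((k : ℝ) - 2) ≤
      P.real {ω | 3 ≤ (Finset.univ.filter (fun j : Fin k => 3 ≤ C i j ω)).card} := fun i => by
    have hmean : ∫ ω, (((Finset.univ.filter (fun j : Fin k => 3 ≤ C i j ω)).card : ℝ) - 2) /
        ((k : ℝ) - 2) ∂P = (k * q - 2) / ((k : ℝ) - 2) := by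
      rw [integral_div, integral_sub (hcount i).1 (integrable_const _), (hcount i).2]
      simp [fun j => measureReal_three_le_of_poisson P (hmeas i j) (hpois i j), q, mul_sub]
    rw [← hmean, ← integral_indicator_one (hident i)]
    refine integral_mono (((hcount i).1.sub (integrable_const _)).div_const _)
      ((integrable_const (1 : ℝ)).indicator (hident i)) fun ω => ?_
    simpa [Set.indicator_apply] using count_sub_two_div_le_ite hk
      ((Finset.card_filter_le Finset.univ fun j : Fin k => 3 ≤ C i j ω).trans_eq (by simp))
  rw [integral_div, hrecall, le_div_iff₀ hn']
  simpa [mul_comm] using Finset.sum_le_sum fun i (_ : i ∈ Finset.univ) => hrecord i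
end

section
/- (Theorem 3, exact lower bound on expected recall of ReconSMOTE.) Let n ≥ 1 and k ≥ 3 be integers, and let p ∈ [0,1]. On a probability space (Ω, P), let C_{i,j} for i ∈ {1,…,n} and j ∈ {1,…,k} be (not necessarily independent) ℕ-valued random variables such that P(C_{i,j} ≥ 3) = p for every i, j. Say record i is identifiable if at least 3 of the k counts C_{i,1}, …, C_{i,k} are at least 3, and define Recall = (1/n)·#{i : i is identifiable}. Then E[Recall] ≥ max{0, (k·p − 2)/(k − 2)}. In particular this holds with p = p_edge(α) = (1 − α)·P(Binom(m, q) ≥ 3) + α·P(Binom(m, 2q) ≥ 3) for any α ∈ [0,1], m ∈ ℕ, and q ∈ [0, 1/2]. -/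
open MeasureTheory Finset

/-- Probability that a Binomial(m, q) random variable equals `i`:
`C(m,i) q^i (1−q)^{m−i}`. -/
noncomputable def binomialPMFReal (m : ℕ) (q : ℝ) (i : ℕ) : ℝ :=
  (m.choose i : ℝ) * q ^ i * (1 - q) ^ (m - i)

/-- Probability that a Binomial(m, q) random variable is at least `t`. -/
noncomputable def binomialGe (m : ℕ) (q : ℝ) (t : ℕ) : ℝ :=
  ∑ i ∈ Finset.Icc t m, binomialPMFReal m q i

/-- For a count `c ≤ k`, the ratio `(c - 2) / (k - 2)` is at most the indicator of `3 ≤ c`. -/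
theorem card_sub_two_div_le_indicator {k c : ℕ} (hk : 3 ≤ k) (hc : c ≤ k) :
    ((c : ℝ) - 2) / ((k : ℝ) - 2) ≤ if 3 ≤ c then 1 else 0 := by
  have hk' : (3 : ℝ) ≤ k := by exact_mod_cast hk
  have hc' : (c : ℝ) ≤ k := by exact_mod_cast hc
  split_ifs with h
  · exact (div_le_one (by linarith)).2 (by linarith)
  · have : (c : ℝ) ≤ 2 := by exact_mod_cast (by omega : c ≤ 2)
    exact div_nonpos_of_nonpos_of_nonneg (by linarith) (by linarith)

/-- The count of events among a finite family that occur is integrable, with expectation the sum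
of the probabilities. -/
theorem integrable_and_integral_card_filter {Ω ι : Type*} [MeasurableSpace Ω] [Fintype ι]
    (P : Measure Ω) [IsFiniteMeasure P] (s : ι → Ω → Prop) [∀ i ω, Decidable (s i ω)]
    (hs : ∀ i, MeasurableSet {ω | s i ω}) :
    Integrable (fun ω => ((univ.filter fun i => s i ω).card : ℝ)) P ∧
      ∫ ω, ((univ.filter fun i => s i ω).card : ℝ) ∂P = ∑ i, P.real {ω | s i ω} := by
  have hcard : (fun ω => ((univ.filter fun i => s i ω).card : ℝ)) =
      fun ω => ∑ i, {ω | s i ω}.indicator (fun _ => (1 : ℝ)) ω := by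
    ext ω
    simp [Set.indicator_apply, Finset.sum_boole]
  have hint : ∀ i, Integrable ({ω | s i ω}.indicator fun _ => (1 : ℝ)) P := fun i =>
    (integrable_const 1).indicator (hs i)
  rw [hcard]
  refine ⟨integrable_finsetSum _ fun i _ => hint i, ?_⟩
  rw [integral_finsetSum _ fun i _ => hint i]
  exact Finset.sum_congr rfl fun i _ => integral_indicator_one (hs i)

/-- **Theorem 3, exact lower bound on expected recall of ReconSMOTE.**
Let `n ≥ 1`, `k ≥ 3`, `p ∈ [0,1]`, and let `C i j` be (not necessarily independent)
`ℕ`-valued random variables with `P(C i j ≥ 3) = p` for all `i, j`. Record `i` is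
identifiable if at least 3 of the `k` counts `C i 1, …, C i k` are at least 3, and
`Recall` is the fraction of identifiable records. Then
`E[Recall] ≥ max {0, (k·p − 2)/(k − 2)}`. In particular (since `p` ranges over all of
`[0,1]`) this holds with `p = p_edge(α) = (1−α)·P(Binom(m,q) ≥ 3) + α·P(Binom(m,2q) ≥ 3)`
for any `α ∈ [0,1]`, `m ∈ ℕ`, `q ∈ [0,1/2]`. -/
theorem reconSMOTE_expected_recall_exact
    {Ω : Type*} [MeasurableSpace Ω] (P : Measure Ω) [IsProbabilityMeasure P]
    (n k : ℕ) (hn : 1 ≤ n) (hk : 3 ≤ k) (p : ℝ) (hp0 : 0 ≤ p) (hp1 : p ≤ 1)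
    (C : Fin n → Fin k → Ω → ℕ) (hmeas : ∀ i j, Measurable (C i j))
    (hedge : ∀ i j, (P {ω | 3 ≤ C i j ω}).toReal = p) :
    max 0 (((k : ℝ) * p - 2) / ((k : ℝ) - 2))
      ≤ ∫ ω, (((Finset.univ.filter (fun i : Fin n =>
          3 ≤ (Finset.univ.filter (fun j : Fin k => 3 ≤ C i j ω)).card)).card : ℝ) / n) ∂P := by
  refine max_le (integral_nonneg fun ω => by positivity) ?_
  have hk' : (3 : ℝ) ≤ k := by exact_mod_cast hk
  have hn' : (0 : ℝ) < n := by exact_mod_cast hn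
  have hedge_meas : ∀ i j, MeasurableSet {ω | 3 ≤ C i j ω} := fun i j =>
    measurableSet_le measurable_const (hmeas i j)
  have hcount := fun i => integrable_and_integral_card_filter P
    (fun (j : Fin k) ω => 3 ≤ C i j ω) (hedge_meas i)
  have hcount_meas : ∀ i : Fin n,
      Measurable fun ω => (univ.filter fun j : Fin k => 3 ≤ C i j ω).card := fun i => by
    simp only [Finset.card_filter]
    exact Finset.measurable_sum _ fun j _ =>
      Measurable.ite (hedge_meas i j) measurable_const measurable_const
  have hident_meas : ∀ i : Fin n,
      MeasurableSet {ω | 3 ≤ (univ.filter fun j : Fin k => 3 ≤ C i j ω).card} := fun i =>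
    measurableSet_le measurable_const (hcount_meas i)
  have hrecord : ∀ i : Fin n, ((k : ℝ) * p - 2) / ((k : ℝ) - 2) ≤
      P.real {ω | 3 ≤ (univ.filter fun j : Fin k => 3 ≤ C i j ω).card} := fun i => by
    have hmean : ∫ ω, (((univ.filter fun j : Fin k => 3 ≤ C i j ω).card : ℝ) - 2) / ((k : ℝ) - 2) ∂P
        = ((k : ℝ) * p - 2) / ((k : ℝ) - 2) := by
      rw [integral_div, integral_sub (hcount i).1 (integrable_const 2), (hcount i).2]
      simp [Measure.real, hedge]
    rw [← hmean, ← integral_indicator_one (hident_meas i)]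
    refine integral_mono (((hcount i).1.sub (integrable_const 2)).div_const _)
      ((integrable_const 1).indicator (hident_meas i)) fun ω => ?_
    simpa [Set.indicator_apply] using card_sub_two_div_le_indicator hk
      ((Finset.card_le_univ (univ.filter fun j : Fin k => 3 ≤ C i j ω)).trans_eq (Fintype.card_fin k))
  rw [integral_div, (integrable_and_integral_card_filter P _ hident_meas).2, le_div_iff₀ hn']
  simpa [mul_comm] using Finset.card_nsmul_le_sum univ _ _ fun i _ => hrecord i
end
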